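/- Let ℓ ∈ ℕ and let K be the Legendre covariance kernel of degree ℓ. Then for every θ ∈ (0, π) and every φ ∈ ℝ, evaluating at the diagonal point θ₁ = θ₂ = θ, φ₁ = φ₂ = φ one has (1/sin²θ) · ∂⁴K/∂φ₁∂θ₁∂φ₂∂θ₂ = P_ℓ''(1) + cot²θ · P_ℓ'(1). -/

import Mathlib

open Real MeasureTheory

/-- The `l`-th Legendre polynomial, via Rodrigues' formula. -/
noncomputable def legendre (l : ℕ) : ℝ → ℝ :=
  fun t => (1 / (2 ^ l * (Nat.factorial l : ℝ))) * iteratedDeriv l (fun s => (s ^ 2 - 1) ^ l) t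

/-- The Legendre covariance kernel of degree `l`. -/
noncomputable def legendreKernel (l : ℕ) (θ₁ φ₁ θ₂ φ₂ : ℝ) : ℝ :=
  legendre l (Real.cos θ₁ * Real.cos θ₂ + Real.sin θ₁ * Real.sin θ₂ * Real.cos (φ₁ - φ₂))

open scoped ContDiff in
theorem contDiff_legendre (l : ℕ) : ContDiff ℝ ∞ (legendre l) := by
  have h : ContDiff ℝ ∞ (fun s : ℝ => (s ^ 2 - 1) ^ l) := by fun_prop
  have h' := h.iterate_deriv l
  rw [← iteratedDeriv_eq_iterate] at h'
  exact contDiff_const.mul h'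

/-- The mixed fourth derivative on the diagonal of a zonal kernel with profile `P`. -/
theorem deriv_zonal_diagonal {P P₁ P₂ P₃ : ℝ → ℝ} (h₁ : ∀ t, HasDerivAt P (P₁ t) t)
    (h₂ : ∀ t, HasDerivAt P₁ (P₂ t) t) (h₃ : ∀ t, HasDerivAt P₂ (P₃ t) t) (θ φ : ℝ) :
    deriv (fun θ₂ => deriv (fun φ₂ => deriv (fun θ₁ => deriv (fun φ₁ =>
      P (cos θ₁ * cos θ₂ + sin θ₁ * sin θ₂ * cos (φ₁ - φ₂))) φ) θ) φ) θ =
      sin θ ^ 2 * P₂ 1 + cos θ ^ 2 * P₁ 1 := by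
  have hφ₁ (θ₁ θ₂ φ₂ : ℝ) :
      deriv (fun φ₁ => P (cos θ₁ * cos θ₂ + sin θ₁ * sin θ₂ * cos (φ₁ - φ₂))) φ =
        P₁ (cos θ₁ * cos θ₂ + sin θ₁ * sin θ₂ * cos (φ - φ₂)) *
          (sin θ₁ * sin θ₂ * -sin (φ - φ₂)) := by
    have hu : HasDerivAt (fun x => cos θ₁ * cos θ₂ + sin θ₁ * sin θ₂ * cos (x - φ₂))
        (sin θ₁ * sin θ₂ * -sin (φ - φ₂)) φ := by
      simpa using ((((hasDerivAt_id φ).sub_const φ₂).cos).const_mul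
        (sin θ₁ * sin θ₂)).const_add (cos θ₁ * cos θ₂)
    exact ((h₁ _).comp φ hu).deriv
  have hθ₁ (θ₂ φ₂ : ℝ) :
      deriv (fun θ₁ => P₁ (cos θ₁ * cos θ₂ + sin θ₁ * sin θ₂ * cos (φ - φ₂)) *
          (sin θ₁ * sin θ₂ * -sin (φ - φ₂))) θ =
        (P₂ (cos θ * cos θ₂ + sin θ * sin θ₂ * cos (φ - φ₂)) *
          (-sin θ * cos θ₂ + cos θ * sin θ₂ * cos (φ - φ₂)) * sin θ +
        P₁ (cos θ * cos θ₂ + sin θ * sin θ₂ * cos (φ - φ₂)) * cos θ) *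
          (sin θ₂ * -sin (φ - φ₂)) := by
    have hu : HasDerivAt (fun x => cos x * cos θ₂ + sin x * sin θ₂ * cos (φ - φ₂))
        (-sin θ * cos θ₂ + cos θ * sin θ₂ * cos (φ - φ₂)) θ :=
      ((hasDerivAt_cos θ).mul_const _).add (((hasDerivAt_sin θ).mul_const _).mul_const _)
    have hd := ((h₂ _).comp θ hu).mul
      (((hasDerivAt_sin θ).mul_const (sin θ₂)).mul_const (-sin (φ - φ₂)))
    refine hd.deriv.trans ?_
    simp only [Function.comp_apply]
    ring
  have hφ₂ (θ₂ : ℝ) :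
      deriv (fun φ₂ => (P₂ (cos θ * cos θ₂ + sin θ * sin θ₂ * cos (φ - φ₂)) *
          (-sin θ * cos θ₂ + cos θ * sin θ₂ * cos (φ - φ₂)) * sin θ +
        P₁ (cos θ * cos θ₂ + sin θ * sin θ₂ * cos (φ - φ₂)) * cos θ) *
          (sin θ₂ * -sin (φ - φ₂))) φ =
        (P₂ (cos θ * cos θ₂ + sin θ * sin θ₂) * (-sin θ * cos θ₂ + cos θ * sin θ₂) * sin θ +
        P₁ (cos θ * cos θ₂ + sin θ * sin θ₂) * cos θ) * sin θ₂ := by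
    have hP₁ : Differentiable ℝ P₁ := fun t => (h₂ t).differentiableAt
    have hP₂ : Differentiable ℝ P₂ := fun t => (h₃ t).differentiableAt
    have hA : DifferentiableAt ℝ (fun φ₂ =>
        P₂ (cos θ * cos θ₂ + sin θ * sin θ₂ * cos (φ - φ₂)) *
          (-sin θ * cos θ₂ + cos θ * sin θ₂ * cos (φ - φ₂)) * sin θ +
        P₁ (cos θ * cos θ₂ + sin θ * sin θ₂ * cos (φ - φ₂)) * cos θ) φ := by
      fun_prop
    have hs := ((((hasDerivAt_id φ).const_sub φ).sin).neg).const_mul (sin θ₂)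
    refine (hA.hasDerivAt.mul hs).deriv.trans ?_
    simp
  have hu : HasDerivAt (fun x => cos θ * cos x + sin θ * sin x)
      (cos θ * -sin θ + sin θ * cos θ) θ :=
    ((hasDerivAt_cos θ).const_mul _).add ((hasDerivAt_sin θ).const_mul _)
  have hv : HasDerivAt (fun x => -sin θ * cos x + cos θ * sin x)
      (-sin θ * -sin θ + cos θ * cos θ) θ :=
    ((hasDerivAt_cos θ).const_mul _).add ((hasDerivAt_sin θ).const_mul _)
  have hd := ((((((h₃ _).comp θ hu).mul hv).mul_const (sin θ)).add
    (((h₂ _).comp θ hu).mul_const (cos θ))).mul (hasDerivAt_sin θ))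
  simp only [hφ₁, hθ₁, hφ₂]
  refine hd.deriv.trans ?_
  have hone : cos θ * cos θ + sin θ * sin θ = 1 := by
    linarith [sin_sq_add_cos_sq θ]
  have hone' : -sin θ * -sin θ + cos θ * cos θ = 1 := by linarith
  have hz : -sin θ * cos θ + cos θ * sin θ = 0 := by ring
  have hz' : cos θ * -sin θ + sin θ * cos θ = 0 := by ring
  simp only [Pi.add_apply, Pi.mul_apply, Function.comp_apply, hone, hone', hz, hz']
  ring

theorem stmt9 (l : ℕ) (θ φ : ℝ) (hθ : θ ∈ Set.Ioo 0 Real.pi) :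
    (1 / Real.sin θ ^ 2) *
      deriv (fun θ₂ =>
        deriv (fun φ₂ =>
          deriv (fun θ₁ => deriv (fun φ₁ => legendreKernel l θ₁ φ₁ θ₂ φ₂) φ) θ) φ) θ =
      iteratedDeriv 2 (legendre l) 1 + (Real.cos θ / Real.sin θ) ^ 2 * deriv (legendre l) 1 := by
  have hs : sin θ ≠ 0 := (sin_pos_of_mem_Ioo hθ).ne'
  have hderiv (n : ℕ) (t : ℝ) :
      HasDerivAt (iteratedDeriv n (legendre l)) (iteratedDeriv (n + 1) (legendre l) t) t := by
    rw [iteratedDeriv_succ]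
    exact ((contDiff_legendre l).differentiable_iteratedDeriv n
      (by exact_mod_cast WithTop.coe_lt_top n) t).hasDerivAt
  have h := deriv_zonal_diagonal (hderiv 0) (hderiv 1) (hderiv 2) θ φ
  simp only [iteratedDeriv_zero, zero_add, iteratedDeriv_one, Nat.reduceAdd] at h
  simp only [legendreKernel]
  rw [h]
  field_simp
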